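/- Let G be a finite connected simple graph with sink r, source set U ⊆ V∖{r}, report sizes s with s(u) ≥ 1 for u ∈ U and s(v) = 0 otherwise, aggregation ratio q ≥ 1, and Tx, Rx > 0. Then every routing tree with relay nodes T satisfies COST(T) ≥ (Tx+Rx)·m, where m is the minimum number of edges of a connected subgraph of G containing U ∪ {r} (the number of edges of a minimum Steiner tree for U ∪ {r}). -/

import Mathlib

open Finset

variable {V : Type*} [Fintype V] [DecidableEq V]

/-- A routing tree with relay nodes for a network `G` with sink `r` and source set `U`:
a subtree of `G` rooted at `r` whose vertex set contains `U ∪ {r}`. Every vertex `v ≠ r`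
of the tree has a unique parent adjacent to it in `G`, and iterating parents reaches `r`. -/
structure RelayTree (G : SimpleGraph V) (r : V) (U : Finset V) where
  verts : Finset V
  root_mem : r ∈ verts
  source_subset : U ⊆ verts
  parent : V → V
  parent_mem : ∀ v ∈ verts, parent v ∈ verts
  parent_root : parent r = r
  adj : ∀ v ∈ verts, v ≠ r → G.Adj v (parent v)
  reaches : ∀ v ∈ verts, ∃ n, parent^[n] v = r

open scoped Classical in
/-- `desR s T v`: the total size of reports of the proper descendants of `v` in `T`,
i.e. of the vertices `u ≠ v` of `T` whose tree path to the root passes through `v`. -/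
noncomputable def desR {G : SimpleGraph V} {r : V} {U : Finset V} (s : V → ℕ)
    (T : RelayTree G r U) (v : V) : ℕ :=
  ∑ u ∈ T.verts, if u ≠ v ∧ (∃ n, T.parent^[n] u = v) then s u else 0

/-- The energy cost of a routing tree with relay nodes:
`COST(T) = (Tx+Rx) · Σ_{v ∈ V(T), v ≠ r} ⌈(des_T(v)+s(v))/q⌉`. -/
noncomputable def costR {G : SimpleGraph V} {r : V} {U : Finset V} (s : V → ℕ) (q : ℕ)
    (Tx Rx : ℝ) (T : RelayTree G r U) : ℝ :=
  (Tx + Rx) * ∑ v ∈ T.verts.erase r, (⌈(((desR s T v + s v : ℕ) : ℝ) / (q : ℝ))⌉ : ℝ)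

/-- The hop distance from `v` to the root `r` in the tree `T`. -/
noncomputable def relayDist {G : SimpleGraph V} {r : V} {U : Finset V}
    (T : RelayTree G r U) (v : V) : ℕ :=
  sInf {n : ℕ | T.parent^[n] v = r}

/-- The minimum number of edges of a connected subgraph of `G` containing `U ∪ {r}`
(the number of edges of a minimum Steiner tree for `U ∪ {r}`). -/
noncomputable def steinerEdges (G : SimpleGraph V) (U : Finset V) (r : V) : ℕ :=
  sInf {k : ℕ | ∃ H : G.Subgraph, H.Connected ∧ (↑U ∪ {r} : Set V) ⊆ H.verts ∧
    H.edgeSet.ncard = k}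

namespace RelayTree

variable {G : SimpleGraph V} {r : V} {U : Finset V}

omit [Fintype V] [DecidableEq V] in
lemma iterate_parent_mem (T : RelayTree G r U) {v : V} (hv : v ∈ T.verts) (n : ℕ) :
    T.parent^[n] v ∈ T.verts := by
  induction n with
  | zero => simpa
  | succ n ih => rw [Function.iterate_succ_apply']; exact T.parent_mem _ ih

/-- The vertices of `T` lying on the tree path from some source to the root. -/
def pathVerts (T : RelayTree G r U) : Set V :=
  {v | v = r ∨ ∃ u ∈ U, ∃ n, T.parent^[n] u = v}

omit [Fintype V] [DecidableEq V] in
lemma pathVerts_subset (T : RelayTree G r U) : T.pathVerts ⊆ T.verts := by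
  rintro v (rfl | ⟨u, hu, n, rfl⟩)
  · exact T.root_mem
  · exact T.iterate_parent_mem (T.source_subset hu) n

omit [Fintype V] [DecidableEq V] in
lemma parent_mem_pathVerts (T : RelayTree G r U) {v : V} (hv : v ∈ T.pathVerts) :
    T.parent v ∈ T.pathVerts := by
  rcases hv with rfl | ⟨u, hu, n, rfl⟩
  · exact Or.inl T.parent_root
  · exact Or.inr ⟨u, hu, n + 1, Function.iterate_succ_apply' _ _ _⟩

/-- The subgraph of `G` formed by the tree paths from the sources to the root. -/
def pathSubgraph (T : RelayTree G r U) : G.Subgraph where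
  verts := T.pathVerts
  Adj a b := (a ∈ T.pathVerts ∧ a ≠ r ∧ T.parent a = b) ∨
    (b ∈ T.pathVerts ∧ b ≠ r ∧ T.parent b = a)
  adj_sub := by
    rintro a b (⟨h, hr, rfl⟩ | ⟨h, hr, rfl⟩)
    · exact T.adj _ (T.pathVerts_subset h) hr
    · exact (T.adj _ (T.pathVerts_subset h) hr).symm
  edge_vert := by
    rintro a b (⟨h, -, -⟩ | ⟨h, -, rfl⟩)
    · exact h
    · exact T.parent_mem_pathVerts h
  symm := ⟨fun _ _ h => h.symm⟩

omit [Fintype V] [DecidableEq V] in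
lemma pathSubgraph_connected (T : RelayTree G r U) : T.pathSubgraph.Connected := by
  have hr : r ∈ T.pathSubgraph.verts := Or.inl rfl
  have key : ∀ n v (hv : v ∈ T.pathSubgraph.verts), T.parent^[n] v = r →
      T.pathSubgraph.coe.Reachable ⟨v, hv⟩ ⟨r, hr⟩ := by
    intro n
    induction n with
    | zero =>
      intro v hv hn
      obtain rfl : v = r := hn
      exact SimpleGraph.Reachable.refl _
    | succ n ih =>
      intro v hv hn
      by_cases hvr : v = r
      · subst hvr
        exact SimpleGraph.Reachable.refl _
      · have hadj : T.pathSubgraph.coe.Adj ⟨v, hv⟩ ⟨T.parent v, T.parent_mem_pathVerts hv⟩ :=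
          Or.inl ⟨hv, hvr, rfl⟩
        exact hadj.reachable.trans (ih _ _ hn)
  rw [SimpleGraph.Subgraph.connected_iff']
  refine (SimpleGraph.connected_iff_exists_forall_reachable _).2 ⟨⟨r, hr⟩, ?_⟩
  rintro ⟨v, hv⟩
  obtain ⟨n, hn⟩ := T.reaches v (T.pathVerts_subset hv)
  exact (key n v hv hn).symm

lemma steinerEdges_le_ncard_pathVerts (T : RelayTree G r U) :
    steinerEdges G U r ≤ (T.pathVerts \ {r}).ncard := by
  have hle : steinerEdges G U r ≤ T.pathSubgraph.edgeSet.ncard := by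
    refine Nat.sInf_le ⟨T.pathSubgraph, T.pathSubgraph_connected, ?_, rfl⟩
    rintro v (hv | hv)
    · exact Or.inr ⟨v, hv, 0, rfl⟩
    · exact Or.inl hv
  have hsub : T.pathSubgraph.edgeSet ⊆ (fun v => s(v, T.parent v)) '' (T.pathVerts \ {r}) := by
    intro e
    induction e with
    | _ a b =>
      intro hab
      rcases SimpleGraph.Subgraph.mem_edgeSet.1 hab with ⟨h, hr, rfl⟩ | ⟨h, hr, rfl⟩
      · exact ⟨a, ⟨h, hr⟩, rfl⟩
      · exact ⟨b, ⟨h, hr⟩, Sym2.eq_swap⟩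
  exact hle.trans ((Set.ncard_le_ncard hsub (Set.toFinite _)).trans
    (Set.ncard_image_le (Set.toFinite _)))

omit [Fintype V] in
lemma one_le_desR_add (T : RelayTree G r U) {s : V → ℕ} (hsU : ∀ u ∈ U, 1 ≤ s u) {v : V}
    (hv : v ∈ T.pathVerts) (hvr : v ≠ r) : 1 ≤ desR s T v + s v := by
  classical
  obtain ⟨u, hu, hn⟩ := hv.resolve_left hvr
  by_cases huv : u = v
  · subst huv
    exact le_add_left (hsU u hu)
  · refine le_add_right ((hsU u hu).trans ?_)
    unfold desR
    refine le_trans ?_ (Finset.single_le_sum (fun _ _ => Nat.zero_le _) (T.source_subset hu))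
    rw [if_pos ⟨huv, hn⟩]

end RelayTree

/-- Every routing tree with relay nodes `T` satisfies `COST(T) ≥ (Tx+Rx)·m`, where `m` is
the minimum number of edges of a connected subgraph of `G` containing `U ∪ {r}`. -/
theorem costR_ge_steiner_edges (G : SimpleGraph V) (hG : G.Connected) (r : V)
    (U : Finset V) (hU : r ∉ U)
    (s : V → ℕ) (hsU : ∀ u ∈ U, 1 ≤ s u) (hs0 : ∀ v, v ∉ U → s v = 0)
    (q : ℕ) (hq : 1 ≤ q) (Tx Rx : ℝ) (hTx : 0 < Tx) (hRx : 0 < Rx)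
    (T : RelayTree G r U) :
    (Tx + Rx) * (steinerEdges G U r : ℝ) ≤ costR s q Tx Rx T := by
  classical
  unfold costR
  refine mul_le_mul_of_nonneg_left ?_ (add_pos hTx hRx).le
  have hq' : (0 : ℝ) < q := by exact_mod_cast hq
  have hcard : steinerEdges G U r ≤ #{v ∈ T.verts.erase r | v ∈ T.pathVerts} := by
    refine T.steinerEdges_le_ncard_pathVerts.trans ?_
    rw [← Set.ncard_coe_finset]
    refine Set.ncard_le_ncard ?_ (Finset.finite_toSet _)
    rintro v ⟨hv, hvr⟩
    exact mem_coe.2 (mem_filter.2 ⟨mem_erase.2 ⟨hvr, T.pathVerts_subset hv⟩, hv⟩)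
  calc (steinerEdges G U r : ℝ)
      ≤ (#{v ∈ T.verts.erase r | v ∈ T.pathVerts} : ℝ) := by exact_mod_cast hcard
    _ = ∑ v ∈ T.verts.erase r, if v ∈ T.pathVerts then (1 : ℝ) else 0 := by simp
    _ ≤ _ := by
      refine Finset.sum_le_sum fun v hv => ?_
      split_ifs with h
      · have h1 := T.one_le_desR_add hsU h (ne_of_mem_erase hv)
        have h2 : (0 : ℝ) < (desR s T v + s v : ℕ) := by exact_mod_cast h1
        exact_mod_cast Int.one_le_ceil_iff.2 (div_pos h2 hq')
      · exact_mod_cast Int.ceil_nonneg (div_nonneg (Nat.cast_nonneg _) hq'.le)
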